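/- Let N ≥ 1 and 0 < ε < β ≤ 1. If u : ℝ^N → ℝ is bounded and uniformly β-Hölder continuous, then (I−Δ)^{log} u is (β−ε)-Hölder continuous, and there exists a constant C = C(N, β, ε) > 0 such that |(I−Δ)^{log}u(x₁) − (I−Δ)^{log}u(x₂)| ≤ C ‖u‖_{C^β(ℝ^N)} |x₁ − x₂|^{β−ε} for all x₁, x₂ ∈ ℝ^N. -/

import Mathlib

open MeasureTheory Filter Topology Set
open scoped ENNReal NNReal

/-- The profile function `ω(r) = ∫₀^∞ t^(N/2 - 1) e^{-t - r²/(4t)} dt`. -/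
noncomputable def omega0 (N : ℕ) (r : ℝ) : ℝ :=
  ∫ t in Set.Ioi (0:ℝ), t ^ ((N : ℝ) / 2 - 1) * Real.exp (-t - r ^ 2 / (4 * t))

/-- The jump kernel `J(y) = π^{-N/2} ω(|y|) / |y|^N` of the variance gamma process. -/
noncomputable def kerJ (N : ℕ) (y : EuclideanSpace ℝ (Fin N)) : ℝ :=
  Real.pi ^ (-(N : ℝ) / 2) * omega0 N ‖y‖ / ‖y‖ ^ (N : ℝ)

/-- The logarithmic Schrödinger operator
`(I-Δ)^{log} u(x) = ∫ (u(x) - u(x+y)) J(y) dy`. -/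
noncomputable def logSchrodinger (N : ℕ) (u : EuclideanSpace ℝ (Fin N) → ℝ)
    (x : EuclideanSpace ℝ (Fin N)) : ℝ :=
  ∫ y : EuclideanSpace ℝ (Fin N), (u x - u (x + y)) * kerJ N y

theorem aux_omega_nonneg (N : ℕ) (r : ℝ) : 0 ≤ omega0 N r := by
  unfold omega0
  refine setIntegral_nonneg measurableSet_Ioi fun t ht => ?_
  have : (0:ℝ) < t := ht
  positivity

theorem aux_omega_meas (N : ℕ) : StronglyMeasurable (omega0 N) := by
  unfold omega0
  refine StronglyMeasurable.integral_prod_right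
    (f := fun r t : ℝ => t ^ ((N : ℝ) / 2 - 1) * Real.exp (-t - r ^ 2 / (4 * t))) ?_
  apply Measurable.stronglyMeasurable
  simp only [Function.uncurry_def]
  fun_prop

theorem aux_omega_le (N : ℕ) (hN : 1 ≤ N) (r : ℝ) : omega0 N r ≤ Real.Gamma ((N : ℝ) / 2) := by
  have h0 : (0:ℝ) < (N : ℝ) / 2 := by
    have : (1:ℝ) ≤ N := by exact_mod_cast hN
    linarith
  rw [Real.Gamma_eq_integral h0]
  unfold omega0
  refine integral_mono_of_nonneg ?_ (Real.GammaIntegral_convergent h0) ?_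
  · filter_upwards [ae_restrict_mem measurableSet_Ioi] with t ht
    have : (0:ℝ) < t := ht
    simp only [Pi.zero_apply]
    positivity
  · filter_upwards [ae_restrict_mem measurableSet_Ioi] with t ht
    have : (0:ℝ) < t := ht
    rw [mul_comm]
    gcongr
    have : 0 ≤ r ^ 2 / (4 * t) := by positivity
    linarith

theorem aux_omega_le2 (N : ℕ) (r : ℝ) (hr : 0 < r) :
    omega0 N r ≤ 4 / r ^ 2 * Real.Gamma ((N : ℝ) / 2 + 1) := by
  have h0 : (0:ℝ) < (N : ℝ) / 2 + 1 := by positivity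
  rw [Real.Gamma_eq_integral h0, ← integral_const_mul]
  unfold omega0
  refine integral_mono_of_nonneg ?_ ((Real.GammaIntegral_convergent h0).const_mul _) ?_
  · filter_upwards [ae_restrict_mem measurableSet_Ioi] with t ht
    have : (0:ℝ) < t := ht
    simp only [Pi.zero_apply]
    positivity
  · filter_upwards [ae_restrict_mem measurableSet_Ioi] with t ht
    have ht : (0:ℝ) < t := ht
    have hx : 0 < r ^ 2 / (4 * t) := by positivity
    have h1 : Real.exp (-(r ^ 2 / (4 * t))) ≤ 4 * t / r ^ 2 := by
      rw [Real.exp_neg, ← inv_div (r ^ 2) (4 * t)]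
      apply inv_anti₀ hx
      have := Real.add_one_le_exp (r ^ 2 / (4 * t))
      linarith
    have h2 : t ^ ((N : ℝ) / 2 + 1 - 1) = t ^ ((N : ℝ) / 2 - 1) * t := by
      rw [← Real.rpow_add_one ht.ne']
      congr 1; ring
    rw [h2, sub_eq_add_neg (-t), Real.exp_add]
    calc t ^ ((N : ℝ) / 2 - 1) * (Real.exp (-t) * Real.exp (-(r ^ 2 / (4 * t))))
        ≤ t ^ ((N : ℝ) / 2 - 1) * (Real.exp (-t) * (4 * t / r ^ 2)) := by gcongr
      _ = _ := by ring

theorem aux_kerJ_nonneg (N : ℕ) (y : EuclideanSpace ℝ (Fin N)) : 0 ≤ kerJ N y := by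
  unfold kerJ
  have := aux_omega_nonneg N ‖y‖
  have := Real.pi_pos
  positivity

theorem aux_kerJ_meas (N : ℕ) : Measurable (kerJ N) := by
  unfold kerJ
  have := (aux_omega_meas N).measurable
  fun_prop

theorem aux_integrable (N : ℕ) (hN : 1 ≤ N) (a : ℝ) (ha : 0 < a) (ha2 : a < 2) :
    Integrable (fun y : EuclideanSpace ℝ (Fin N) => ‖y‖ ^ a * kerJ N y) := by
  have : Nonempty (Fin N) := ⟨⟨0, hN⟩⟩
  have hm := (aux_omega_meas N).measurable
  have key := (integrable_fun_norm_addHaar (E := EuclideanSpace ℝ (Fin N)) volume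
    (f := fun r : ℝ => r ^ a * (Real.pi ^ (-(N : ℝ) / 2) * omega0 N r / r ^ (N : ℝ)))).2
  unfold kerJ
  refine key ?_
  simp only [finrank_euclideanSpace, Fintype.card_fin, smul_eq_mul]
  have heq : ∀ r : ℝ, 0 < r →
      r ^ (N - 1) * (r ^ a * (Real.pi ^ (-(N : ℝ) / 2) * omega0 N r / r ^ (N : ℝ)))
      = Real.pi ^ (-(N : ℝ) / 2) * (r ^ (a - 1) * omega0 N r) := by
    intro r hr
    obtain ⟨k, rfl⟩ : ∃ k, N = k + 1 := ⟨N - 1, by omega⟩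
    rw [Real.rpow_natCast, Real.rpow_sub_one hr.ne', Nat.add_sub_cancel, pow_succ]
    field_simp
  refine IntegrableOn.congr_fun
    (f := fun r => Real.pi ^ (-(N : ℝ) / 2) * (r ^ (a - 1) * omega0 N r)) ?_
    (fun r hr => (heq r hr).symm) measurableSet_Ioi
  refine Integrable.const_mul ?_ _
  rw [← Ioc_union_Ioi_eq_Ioi (zero_le_one (α := ℝ))]
  change IntegrableOn _ _ _
  refine IntegrableOn.union ?_ ?_
  · have h1 : IntegrableOn (fun r : ℝ => r ^ (a - 1)) (Ioc 0 1) := by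
      have := intervalIntegral.intervalIntegrable_rpow' (a := 0) (b := 1) (r := a - 1) (by linarith)
      rwa [intervalIntegrable_iff_integrableOn_Ioc_of_le zero_le_one] at this
    refine Integrable.mono' (h1.mul_const (Real.Gamma ((N : ℝ) / 2))) (by fun_prop) ?_
    filter_upwards [ae_restrict_mem measurableSet_Ioc] with r hr
    have hr0 : 0 < r := hr.1
    have := aux_omega_nonneg N r
    rw [Real.norm_of_nonneg (by positivity)]
    gcongr
    exact aux_omega_le N hN r
  · have h1 : IntegrableOn (fun r : ℝ => r ^ (a - 3)) (Ioi 1) :=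
      integrableOn_Ioi_rpow_of_lt (by linarith) one_pos
    refine Integrable.mono' (h1.mul_const (4 * Real.Gamma ((N : ℝ) / 2 + 1))) (by fun_prop) ?_
    filter_upwards [ae_restrict_mem measurableSet_Ioi] with r hr
    have hr0 : 0 < r := lt_trans one_pos hr
    have := aux_omega_nonneg N r
    rw [Real.norm_of_nonneg (by positivity)]
    have h3 : r ^ (a - 1) = r ^ (a - 3) * r ^ 2 := by
      rw [← Real.rpow_natCast r 2, ← Real.rpow_add hr0]
      congr 1; push_cast; ring
    calc r ^ (a - 1) * omega0 N r
        ≤ r ^ (a - 1) * (4 / r ^ 2 * Real.Gamma ((N : ℝ) / 2 + 1)) := by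
          gcongr
          exact aux_omega_le2 N r hr0
      _ = _ := by rw [h3]; field_simp

theorem aux_interp (p d β ε : ℝ) (hp : 0 ≤ p) (hd : 0 ≤ d) (hε : 0 < ε) (hεβ : ε < β) :
    min (p ^ β) (d ^ β) ≤ p ^ ε * d ^ (β - ε) := by
  have hs : ∀ x : ℝ, 0 ≤ x → x ^ β = x ^ ε * x ^ (β - ε) := by
    intro x hx
    rw [← Real.rpow_add_of_nonneg hx hε.le (by linarith)]
    congr 1; ring
  have hb : 0 ≤ β - ε := by linarith
  rcases le_total p d with h | h
  · refine (min_le_left _ _).trans ?_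
    rw [hs p hp]
    gcongr
  · refine (min_le_right _ _).trans ?_
    rw [hs d hd]
    gcongr

/-- for `0 < ε < β ≤ 1` there is a constant `C = C(N, β, ε) > 0` such that
for every bounded, uniformly `β`-Hölder continuous `u` (with sup bound `M` and Hölder
constant `H`, so that `M + H` plays the role of `‖u‖_{C^β(ℝ^N)}`), the function
`(I-Δ)^{log} u` is `(β-ε)`-Hölder continuous with
`|(I-Δ)^{log}u(x₁) - (I-Δ)^{log}u(x₂)| ≤ C (M + H) |x₁ - x₂|^{β-ε}`. -/
theorem logSchrodinger_holder_regularity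
    (N : ℕ) (hN : 1 ≤ N) (β ε : ℝ) (hε : 0 < ε) (hεβ : ε < β) (hβ : β ≤ 1) :
    ∃ C : ℝ, 0 < C ∧
      ∀ (u : EuclideanSpace ℝ (Fin N) → ℝ) (M H : ℝ),
        (∀ x, |u x| ≤ M) →
        (∀ x y, |u x - u y| ≤ H * ‖x - y‖ ^ β) →
        ∀ x₁ x₂ : EuclideanSpace ℝ (Fin N),
          |logSchrodinger N u x₁ - logSchrodinger N u x₂| ≤
            C * (M + H) * ‖x₁ - x₂‖ ^ (β - ε) := by
  set I : ℝ := ∫ y : EuclideanSpace ℝ (Fin N), ‖y‖ ^ ε * kerJ N y with hI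
  have hI0 : 0 ≤ I := integral_nonneg fun y => mul_nonneg (by positivity) (aux_kerJ_nonneg N y)
  refine ⟨2 * I + 1, by linarith, ?_⟩
  intro u M H hM hH x₁ x₂
  have hM0 : 0 ≤ M := (abs_nonneg _).trans (hM 0)
  have hH0 : 0 ≤ H := by
    have h := (abs_nonneg _).trans (hH (EuclideanSpace.single ⟨0, hN⟩ 1) 0)
    simpa using h
  have hβ0 : 0 < β := hε.trans hεβ
  have hcont : Continuous u := by
    rw [Metric.continuous_iff']
    intro x δ hδ
    have ht : Tendsto (fun y => H * ‖y - x‖ ^ β) (𝓝 x) (𝓝 0) := by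
      have hc : Continuous fun y : EuclideanSpace ℝ (Fin N) => H * ‖y - x‖ ^ β :=
        continuous_const.mul ((continuous_id.sub continuous_const).norm.rpow_const
          fun _ => Or.inr hβ0.le)
      have := hc.tendsto x
      simpa [Real.zero_rpow hβ0.ne'] using this
    filter_upwards [ht.eventually (gt_mem_nhds hδ)] with y hy
    rw [Real.dist_eq]
    exact (hH y x).trans_lt hy
  have hint : ∀ x, Integrable (fun y : EuclideanSpace ℝ (Fin N) =>
      (u x - u (x + y)) * kerJ N y) := by
    intro x
    refine Integrable.mono' ((aux_integrable N hN β hβ0 (by linarith)).const_mul H) ?_ ?_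
    · have := aux_kerJ_meas N
      have := hcont.measurable
      exact Measurable.aestronglyMeasurable (by fun_prop)
    · refine Eventually.of_forall fun y => ?_
      have h := hH x (x + y)
      have hJ := aux_kerJ_nonneg N y
      rw [norm_mul, Real.norm_of_nonneg hJ, Real.norm_eq_abs, ← mul_assoc]
      gcongr
      simpa using h
  unfold logSchrodinger
  rw [← integral_sub (hint x₁) (hint x₂), ← Real.norm_eq_abs]
  have hb : 0 ≤ ‖x₁ - x₂‖ ^ (β - ε) := by positivity
  calc _ ≤ ∫ y : EuclideanSpace ℝ (Fin N),
        (2 * H * ‖x₁ - x₂‖ ^ (β - ε)) * (‖y‖ ^ ε * kerJ N y) := by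
        refine norm_integral_le_of_norm_le
          ((aux_integrable N hN ε hε (by linarith)).const_mul _) (Eventually.of_forall fun y => ?_)
        have hJ := aux_kerJ_nonneg N y
        rw [← sub_mul, norm_mul, Real.norm_of_nonneg hJ, Real.norm_eq_abs, ← mul_assoc]
        gcongr
        have a1 : |u x₁ - u (x₁ + y)| ≤ H * ‖y‖ ^ β := by simpa using hH x₁ (x₁ + y)
        have a2 : |u x₂ - u (x₂ + y)| ≤ H * ‖y‖ ^ β := by simpa using hH x₂ (x₂ + y)
        have a3 := hH x₁ x₂
        have a4 : |u (x₁ + y) - u (x₂ + y)| ≤ H * ‖x₁ - x₂‖ ^ β := by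
          simpa using hH (x₁ + y) (x₂ + y)
        have hi := aux_interp ‖y‖ ‖x₁ - x₂‖ β ε (norm_nonneg _) (norm_nonneg _) hε hεβ
        have hA : |u x₁ - u (x₁ + y) - (u x₂ - u (x₂ + y))|
            ≤ 2 * H * min (‖y‖ ^ β) (‖x₁ - x₂‖ ^ β) := by
          rw [abs_le] at a1 a2 a3 a4 ⊢
          rcases min_choice (‖y‖ ^ β) (‖x₁ - x₂‖ ^ β) with h | h <;> rw [h] <;>
            constructor <;> linarith [a1.1, a1.2, a2.1, a2.2, a3.1, a3.2, a4.1, a4.2]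
        calc _ ≤ _ := hA
          _ ≤ 2 * H * (‖y‖ ^ ε * ‖x₁ - x₂‖ ^ (β - ε)) := by gcongr
          _ = _ := by ring
    _ = 2 * I * H * ‖x₁ - x₂‖ ^ (β - ε) := by rw [integral_const_mul]; ring
    _ ≤ _ := by
        refine mul_le_mul_of_nonneg_right ?_ hb
        nlinarith [mul_nonneg hI0 hM0]
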